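/- For every k ≥ 2, in K[w]: D_k·p_k(w) = a_k·D_k·e_k(w)² + (1 + a_k·D_k²)·e_k(w). (Equivalently, with d_k := 1/a_k: p_k(w) = e_k(w)²/d_k + C·e_k(w) where C = 1/D_k + D_k/d_k.) -/

import Mathlib

noncomputable section

open Polynomial
open scoped Classical

/-- The defining polynomial `Y² + Y + (X³ + X + 1)` over `𝔽₂[X]`,
viewed as a polynomial in `Y` with coefficients in `𝔽₂[X]`. -/
def curveEq : Polynomial (Polynomial (ZMod 2)) :=
  X ^ 2 + X + C (X ^ 3 + X + 1)

/-- The ring `A = 𝔽₂[X,Y]/(Y² + Y + X³ + X + 1)`. -/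
abbrev A : Type := AdjoinRoot curveEq

/-- The image `x` of `X` in `A`. -/
def aX : A := AdjoinRoot.of curveEq (X : Polynomial (ZMod 2))

/-- The image `y` of `Y` in `A`. -/
def aY : A := AdjoinRoot.root curveEq

/-- The bracket `[j]_x = x^{2^j} + x ∈ A`. -/
def brX (j : ℕ) : A := aX ^ 2 ^ j + aX

/-- The monomials `xⁱyʲ` with `j ∈ {0,1}` and `2i + 3j < k`. -/
def monoSet (k : ℕ) : Finset A :=
  ((Finset.range k ×ˢ Finset.range 2).filter fun p => 2 * p.1 + 3 * p.2 < k).image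
    fun p => aX ^ p.1 * aY ^ p.2

/-- `A_{<k}` : the `𝔽₂`-linear span of the monomials `xⁱyʲ` with `j ∈ {0,1}`
and `2i + 3j < k`, realized as the finite set of all subset sums. -/
def Alt (k : ℕ) : Finset A := (monoSet k).powerset.image fun s => s.sum id

/-- `t_k := x^{k/2}` if `k` is even, `t_k := y·x^{(k-3)/2}` if `k` is odd. -/
def tk (k : ℕ) : A := if Even k then aX ^ (k / 2) else aY * aX ^ ((k - 3) / 2)

/-- `e_k(w) := ∏_{a ∈ A_{<k}} (w + a) ∈ A[w]`. -/
def ePoly (k : ℕ) : Polynomial A := ∏ a ∈ Alt k, (X + C a)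

/-- `D_k := e_k(t_k)`, the product of all monic elements of `A` of degree `k`. -/
def Dk (k : ℕ) : A := (ePoly k).eval (tk k)

variable (K : Type) [Field K] [Algebra A K]

/-- The coefficients `a_j = 1/d_j` of the exponential function:
`a₀ = a₁ = 1` and `a_j = ([1]_x·a_{j-1}² + a_{j-2}⁴)/[j]_x` for `j ≥ 2`. -/
def aSeq : ℕ → K
  | 0 => 1
  | 1 => 1
  | (j + 2) =>
      (algebraMap A K (brX 1) * (aSeq (j + 1)) ^ 2 + (aSeq j) ^ 4) /
        algebraMap A K (brX (j + 2))

/-- The coefficients `b_j = 1/ℓ_j` of the logarithm function: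
`b₀ = b₁ = 1` and `b_j = ([1]_x^{2^{j-1}}·b_{j-1} + b_{j-2})/[j]_x` for `j ≥ 2`. -/
def bSeq : ℕ → K
  | 0 => 1
  | 1 => 1
  | (j + 2) =>
      (algebraMap A K (brX 1) ^ 2 ^ (j + 1) * bSeq (j + 1) + bSeq j) /
        algebraMap A K (brX (j + 2))

/-- `p_k(w) := Σ_{j=0}^{k} a_j·b_{k-j}^{2^j}·w^{2^j} ∈ K[w]`. -/
def pPoly (k : ℕ) : Polynomial K :=
  ∑ j ∈ Finset.range (k + 1), C (aSeq K j * (bSeq K (k - j)) ^ 2 ^ j) * X ^ 2 ^ j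

/-- `S_{n,r}(x₁,…,x_n) := Σ_{n ≥ i₁ > i₂ > … > i_r ≥ 1} ∏_{j=1}^{r}
x_{i_j}^{2^{n-j+1-i_j}}`, with `S_{n,0} = 1` and `S_{n,r} = 0` for `r > n`. -/
def Ssum (R : Type*) [CommRing R] (n r : ℕ) (x : ℕ → R) : R :=
  ∑ f ∈ Finset.univ.filter
      (fun f : Fin r → Fin (n + 1) => StrictAnti f ∧ ∀ j, 1 ≤ (f j : ℕ)),
    ∏ j : Fin r, x (f j) ^ 2 ^ (n - (j : ℕ) - (f j : ℕ))

theorem curveEq_degree_ne_zero : curveEq.degree ≠ 0 := by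
  have h : curveEq.degree = 2 := by
    unfold curveEq
    compute_degree!
  rw [h]
  decide

theorem brX_ne_zero {j : ℕ} (hj : 1 ≤ j) : brX j ≠ 0 := by
  have h : brX j = AdjoinRoot.of curveEq (X ^ 2 ^ j + X) := by
    simp [brX, aX]
  rw [h, Ne, map_eq_zero_iff _ (AdjoinRoot.of.injective_of_degree_ne_zero curveEq_degree_ne_zero)]
  intro h0
  have h1 : 1 < 2 ^ j := Nat.one_lt_two_pow (by omega)
  have h2 := congrArg (fun p : Polynomial (ZMod 2) => p.coeff 1) h0
  simp [coeff_X_pow, h1.ne] at h2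

theorem two_eq_zero_A : (2 : A) = 0 := by
  have h : (2 : Polynomial (ZMod 2)) = 0 := CharTwo.two_eq_zero
  rw [← map_ofNat (AdjoinRoot.of curveEq) 2, h, map_zero]

theorem aY_sq : aY ^ 2 + aY + (aX ^ 3 + aX + 1) = 0 := by
  have h := AdjoinRoot.eval₂_root curveEq
  conv at h => enter [1, 3]; rw [curveEq]
  simpa [aX, aY, eval₂_add, eval₂_pow] using h

section Coefficients

variable {K : Type} [Field K] [Algebra A K]

theorem charP_two : CharP K 2 :=
  CharTwo.of_one_ne_zero_of_two_eq_zero one_ne_zero <| by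
    rw [← map_ofNat (algebraMap A K) 2, two_eq_zero_A, map_zero]

theorem algebraMap_brX (j : ℕ) :
    algebraMap A K (brX j) = algebraMap A K aX ^ 2 ^ j + algebraMap A K aX := by
  simp [brX]

theorem pPoly_eval (k : ℕ) (w : K) :
    (pPoly K k).eval w =
      ∑ j ∈ Finset.range (k + 1), aSeq K j * bSeq K (k - j) ^ 2 ^ j * w ^ 2 ^ j := by
  simp [pPoly, eval_finsetSum]

theorem pPoly_eval_zero (k : ℕ) : (pPoly K k).eval 0 = 0 := by
  simp [pPoly_eval]

theorem pPoly_eval_add (k : ℕ) (v w : K) :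
    (pPoly K k).eval (v + w) = (pPoly K k).eval v + (pPoly K k).eval w := by
  have : CharP K 2 := charP_two
  simp only [pPoly_eval, add_pow_char_pow, mul_add, Finset.sum_add_distrib]

theorem pPoly_zero_eval (w : K) : (pPoly K 0).eval w = w := by
  simp [pPoly_eval, aSeq, bSeq]

theorem pPoly_one_eval (w : K) : (pPoly K 1).eval w = w + w ^ 2 := by
  simp [pPoly_eval, Finset.sum_range_succ, aSeq, bSeq]

theorem algebraMap_aY_sq :
    algebraMap A K aY ^ 2 =
      algebraMap A K aY + algebraMap A K aX ^ 3 + algebraMap A K aX + 1 := by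
  have : CharP K 2 := charP_two
  have h := congrArg (algebraMap A K) aY_sq
  simp only [map_add, map_pow, map_one, map_zero] at h
  grind [CharTwo.two_eq_zero (R := K)]

theorem pPoly_sub_mem_degreeLT (k : ℕ) :
    pPoly K k - C (aSeq K k) * X ^ 2 ^ k ∈ degreeLT K (2 ^ k) := by
  rw [pPoly, Finset.sum_range_succ]
  simp only [Nat.sub_self, bSeq, one_pow, mul_one, add_sub_cancel_right]
  refine Submodule.sum_mem _ fun j hj => mem_degreeLT.mpr ?_
  refine (degree_C_mul_X_pow_le _ _).trans_lt ?_
  exact_mod_cast Nat.pow_lt_pow_right one_lt_two (Finset.mem_range.mp hj)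

variable [IsFractionRing A K]

theorem algebraMap_brX_ne_zero {j : ℕ} (hj : 1 ≤ j) : algebraMap A K (brX j) ≠ 0 := by
  rw [Ne, map_eq_zero_iff _ (IsFractionRing.injective A K)]
  exact brX_ne_zero hj

theorem aSeq_mul_pow (j : ℕ) :
    aSeq K (j + 2) * algebraMap A K aX ^ 2 ^ (j + 2) =
      algebraMap A K aX * aSeq K (j + 2) +
        algebraMap A K (brX 1) * aSeq K (j + 1) ^ 2 + aSeq K j ^ 4 := by
  have : CharP K 2 := charP_two
  have h : aSeq K (j + 2) * algebraMap A K (brX (j + 2)) =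
      algebraMap A K (brX 1) * aSeq K (j + 1) ^ 2 + aSeq K j ^ 4 := by
    rw [aSeq]
    exact div_mul_cancel₀ _ (algebraMap_brX_ne_zero (by omega))
  rw [add_assoc, ← h, algebraMap_brX]
  linear_combination -(aSeq K (j + 2) * algebraMap A K aX) * CharTwo.two_eq_zero (R := K)

theorem mul_bSeq (j : ℕ) :
    algebraMap A K aX * bSeq K (j + 2) =
      algebraMap A K aX ^ 2 ^ (j + 2) * bSeq K (j + 2) +
        algebraMap A K (brX 1) ^ 2 ^ (j + 1) * bSeq K (j + 1) + bSeq K j := by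
  have : CharP K 2 := charP_two
  have h : bSeq K (j + 2) * algebraMap A K (brX (j + 2)) =
      algebraMap A K (brX 1) ^ 2 ^ (j + 1) * bSeq K (j + 1) + bSeq K j := by
    rw [bSeq]
    exact div_mul_cancel₀ _ (algebraMap_brX_ne_zero (by omega))
  rw [add_assoc, ← h, algebraMap_brX]
  linear_combination
    -(bSeq K (j + 2) * algebraMap A K aX ^ 2 ^ (j + 2)) * CharTwo.two_eq_zero (R := K)

/-- The functional equation of the exponential: `Φ_{xw} = φ_x ∘ Φ_w` with
`φ_x = x + [1]_x τ + τ²` and `Φ_w = Σ p_k(w) τ^k`. -/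
theorem pPoly_eval_mul_left (k : ℕ) (w : K) :
    (pPoly K (k + 2)).eval (algebraMap A K aX * w) =
      algebraMap A K aX * (pPoly K (k + 2)).eval w +
        algebraMap A K (brX 1) * (pPoly K (k + 1)).eval w ^ 2 + (pPoly K k).eval w ^ 4 := by
  have : CharP K 2 := charP_two
  have h4 (z : K) : z ^ 4 = z ^ 2 ^ 2 := by norm_num
  simp only [pPoly_eval]
  rw [h4, sum_pow_char_pow, sum_pow_char]
  rw [Finset.sum_range_succ' _ (k + 2), Finset.sum_range_succ' _ (k + 1),
    Finset.sum_range_succ' _ (k + 2), Finset.sum_range_succ' _ (k + 1),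
    Finset.sum_range_succ' (fun j => (aSeq K j * bSeq K (k + 1 - j) ^ 2 ^ j * w ^ 2 ^ j) ^ 2)
      (k + 1)]
  have key : ∀ j ∈ Finset.range (k + 1),
      aSeq K (j + 1 + 1) * bSeq K (k + 2 - (j + 1 + 1)) ^ 2 ^ (j + 1 + 1) *
        (algebraMap A K aX * w) ^ 2 ^ (j + 1 + 1) =
      algebraMap A K aX * (aSeq K (j + 1 + 1) * bSeq K (k + 2 - (j + 1 + 1)) ^ 2 ^ (j + 1 + 1) *
        w ^ 2 ^ (j + 1 + 1)) +
      algebraMap A K (brX 1) * (aSeq K (j + 1) * bSeq K (k + 1 - (j + 1)) ^ 2 ^ (j + 1) *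
        w ^ 2 ^ (j + 1)) ^ 2 +
      (aSeq K j * bSeq K (k - j) ^ 2 ^ j * w ^ 2 ^ j) ^ 2 ^ 2 := by
    intro j _
    have e1 : k + 2 - (j + 1 + 1) = k - j := by omega
    have e2 : k + 1 - (j + 1) = k - j := by omega
    rw [e1, e2]
    have ha := aSeq_mul_pow (K := K) j
    have p1 (z : K) : (z ^ 2 ^ (j + 1)) ^ 2 = z ^ 2 ^ (j + 2) := by rw [← pow_mul, ← pow_succ]
    have p2 (z : K) : (z ^ 2 ^ j) ^ 4 = z ^ 2 ^ (j + 2) := by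
      rw [← pow_mul]; congr 1; ring
    rw [← h4]
    simp only [mul_pow, p1, p2]
    linear_combination bSeq K (k - j) ^ 2 ^ (j + 2) * w ^ 2 ^ (j + 2) * ha
  rw [Finset.sum_congr rfl key]
  simp only [Finset.sum_add_distrib, ← Finset.mul_sum, aSeq, algebraMap_brX, zero_add,
    Nat.sub_zero, pow_zero, pow_one, one_mul]
  have e1 : k + 2 - 1 = k + 1 := by omega
  rw [e1]
  linear_combination (-(algebraMap A K aX * bSeq K (k + 1) ^ 2 * w ^ 2)) *
    CharTwo.two_eq_zero (R := K)

/-- The functional equation of the logarithm: `Φ_{xw} = Φ_w ∘ φ_x` with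
`φ_x = x + [1]_x τ + τ²` and `Φ_w = Σ p_k(w) τ^k`. -/
theorem pPoly_eval_mul_right (k : ℕ) (w : K) :
    (pPoly K (k + 2)).eval (algebraMap A K aX * w) =
      algebraMap A K aX ^ 2 ^ (k + 2) * (pPoly K (k + 2)).eval w +
        algebraMap A K (brX 1) ^ 2 ^ (k + 1) * (pPoly K (k + 1)).eval w +
          (pPoly K k).eval w := by
  have : CharP K 2 := charP_two
  simp only [pPoly_eval]
  rw [Finset.sum_range_succ _ (k + 2), Finset.sum_range_succ _ (k + 1),
    Finset.sum_range_succ _ (k + 2), Finset.sum_range_succ _ (k + 1),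
    Finset.sum_range_succ (fun j => aSeq K j * bSeq K (k + 1 - j) ^ 2 ^ j * w ^ 2 ^ j) (k + 1)]
  have key : ∀ j ∈ Finset.range (k + 1),
      aSeq K j * bSeq K (k + 2 - j) ^ 2 ^ j * (algebraMap A K aX * w) ^ 2 ^ j =
      algebraMap A K aX ^ 2 ^ (k + 2) * (aSeq K j * bSeq K (k + 2 - j) ^ 2 ^ j * w ^ 2 ^ j) +
      algebraMap A K (brX 1) ^ 2 ^ (k + 1) *
        (aSeq K j * bSeq K (k + 1 - j) ^ 2 ^ j * w ^ 2 ^ j) +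
      aSeq K j * bSeq K (k - j) ^ 2 ^ j * w ^ 2 ^ j := by
    intro j hj
    obtain ⟨i, rfl⟩ := Nat.exists_eq_add_of_le' (Nat.lt_succ_iff.mp (Finset.mem_range.mp hj))
    have e1 : i + j + 2 - j = i + 2 := by omega
    have e2 : i + j + 1 - j = i + 1 := by omega
    have e3 : i + j - j = i := by omega
    rw [e1, e2, e3]
    have hb := congrArg (· ^ 2 ^ j) (mul_bSeq (K := K) i)
    have p1 (z : K) (m : ℕ) : (z ^ 2 ^ m) ^ 2 ^ j = z ^ 2 ^ (m + j) := by
      rw [← pow_mul, ← pow_add]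
    simp only [add_pow_char_pow, mul_pow, p1] at hb
    rw [show i + j + 2 = i + 2 + j by omega, show i + j + 1 = i + 1 + j by omega, mul_pow]
    linear_combination aSeq K j * w ^ 2 ^ j * hb
  rw [Finset.sum_congr rfl key]
  have e1 : k + 2 - (k + 1) = 1 := by omega
  have p1 (z : K) : z ^ 2 ^ (k + 2) = (z ^ 2) ^ 2 ^ (k + 1) := by rw [← pow_mul, pow_succ']
  simp only [Finset.sum_add_distrib, ← Finset.mul_sum, bSeq, algebraMap_brX, e1,
    Nat.sub_self, pow_one, one_pow, mul_pow, add_pow_char_pow, mul_one]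
  rw [← p1]
  linear_combination (-(algebraMap A K aX ^ 2 ^ (k + 2) * aSeq K (k + 1) * w ^ 2 ^ (k + 1))) *
    CharTwo.two_eq_zero (R := K)

theorem brX_mul_pPoly_eval (k : ℕ) (w : K) :
    algebraMap A K (brX (k + 2)) * (pPoly K (k + 2)).eval w =
      algebraMap A K (brX 1) * (pPoly K (k + 1)).eval w ^ 2 +
        algebraMap A K (brX 1) ^ 2 ^ (k + 1) * (pPoly K (k + 1)).eval w +
          (pPoly K k).eval w ^ 4 + (pPoly K k).eval w := by
  have : CharP K 2 := charP_two
  have h := (pPoly_eval_mul_left k w).symm.trans (pPoly_eval_mul_right k w)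
  rw [algebraMap_brX]
  linear_combination h +
    (algebraMap A K aX ^ 2 ^ (k + 2) * (pPoly K (k + 2)).eval w
      - algebraMap A K (brX 1) * (pPoly K (k + 1)).eval w ^ 2
      - (pPoly K k).eval w ^ 4) * CharTwo.two_eq_zero (R := K)


theorem pPoly_eval_one (k : ℕ) : (pPoly K (k + 1)).eval 1 = 0 := by
  have : CharP K 2 := charP_two
  induction k using Nat.strong_induction_on with
  | _ k ih =>
    match k with
    | 0 => simp [pPoly_one_eval, CharTwo.add_self_eq_zero]
    | k + 1 =>
      have h := brX_mul_pPoly_eval (K := K) k 1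
      rw [ih k (by omega)] at h
      have h0 : (pPoly K k).eval 1 ^ 4 + (pPoly K k).eval 1 = 0 := by
        match k with
        | 0 => simp [pPoly_zero_eval, CharTwo.add_self_eq_zero]
        | k + 1 => simp [ih k (by omega)]
      rw [add_assoc, h0] at h
      simpa [algebraMap_brX_ne_zero (K := K) (show 1 ≤ k + 2 by omega)] using h

theorem pPoly_two_eval_aY :
    (pPoly K 2).eval (algebraMap A K aY) =
      algebraMap A K aX * (algebraMap A K aX ^ 3 + algebraMap A K aX + 1) := by
  have : CharP K 2 := charP_two
  have h2 := CharTwo.two_eq_zero (R := K)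
  have hy := algebraMap_aY_sq (K := K)
  have h := brX_mul_pPoly_eval (K := K) 0 (algebraMap A K aY)
  apply mul_left_cancel₀ (algebraMap_brX_ne_zero (K := K) (show 1 ≤ 2 by omega))
  simp only [zero_add, pPoly_zero_eval, pPoly_one_eval] at h
  rw [h]
  simp only [algebraMap_brX]
  grind

theorem pPoly_three_eval_aY : (pPoly K 3).eval (algebraMap A K aY) = 1 := by
  have : CharP K 2 := charP_two
  have h2 := CharTwo.two_eq_zero (R := K)
  have hy := algebraMap_aY_sq (K := K)
  have h := brX_mul_pPoly_eval (K := K) 1 (algebraMap A K aY)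
  apply mul_left_cancel₀ (algebraMap_brX_ne_zero (K := K) (show 1 ≤ 3 by omega))
  simp only [pPoly_one_eval, pPoly_two_eval_aY, Nat.reduceAdd] at h
  rw [h]
  simp only [algebraMap_brX]
  grind

theorem pPoly_eval_aY (k : ℕ) : (pPoly K (k + 4)).eval (algebraMap A K aY) = 0 := by
  have : CharP K 2 := charP_two
  have h2 := CharTwo.two_eq_zero (R := K)
  induction k using Nat.strong_induction_on with
  | _ k ih =>
    have h := brX_mul_pPoly_eval (K := K) (k + 2) (algebraMap A K aY)
    apply mul_left_cancel₀ (algebraMap_brX_ne_zero (K := K) (show 1 ≤ k + 4 by omega))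
    rw [mul_zero, h]
    clear h
    rcases k with _ | _ | k
    · simp only [zero_add, Nat.reduceAdd, pPoly_two_eval_aY, pPoly_three_eval_aY, algebraMap_brX]
      have h4 (z : K) : z ^ 4 = z ^ 2 ^ 2 := by norm_num
      rw [h4]
      simp only [mul_pow, add_pow_char_pow, one_pow]
      generalize algebraMap A K aX = x
      linear_combination (x + x ^ 2 + x ^ 4 + x ^ 8 + x ^ 16) * h2
    · simp [ih 0 (by omega), pPoly_three_eval_aY, CharTwo.add_self_eq_zero]
    · simp [ih k (by omega), ih (k + 1) (by omega)]

theorem pPoly_eval_pow_mul {w : K} {d : ℕ} (h0 : ∀ m, d < m → (pPoly K m).eval w = 0)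
    (h1 : (pPoly K d).eval w = 1) (i : ℕ) :
    (∀ m, 2 * i + d < m → (pPoly K m).eval (algebraMap A K aX ^ i * w) = 0) ∧
      (pPoly K (2 * i + d)).eval (algebraMap A K aX ^ i * w) = 1 := by
  induction i with
  | zero => simpa using ⟨h0, h1⟩
  | succ i ih =>
    obtain ⟨ih0, ih1⟩ := ih
    constructor
    · intro m hm
      obtain ⟨k, rfl⟩ := Nat.exists_eq_add_of_le' (show 2 ≤ m by omega)
      rw [pow_succ', mul_assoc, pPoly_eval_mul_left, ih0 _ (by omega), ih0 _ (by omega),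
        ih0 _ (by omega)]
      simp
    · rw [show 2 * (i + 1) + d = 2 * i + d + 2 by ring, pow_succ', mul_assoc, pPoly_eval_mul_left,
        ih0 _ (by omega), ih0 _ (by omega), ih1]
      simp

theorem pPoly_eval_monomial (i : ℕ) {j : ℕ} (hj : j < 2) :
    (∀ m, 2 * i + 3 * j < m → (pPoly K m).eval (algebraMap A K (aX ^ i * aY ^ j)) = 0) ∧
      (pPoly K (2 * i + 3 * j)).eval (algebraMap A K (aX ^ i * aY ^ j)) = 1 := by
  rw [map_mul, map_pow, map_pow]
  apply pPoly_eval_pow_mul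
  · intro m hm
    interval_cases j
    · obtain ⟨k, rfl⟩ := Nat.exists_eq_add_of_le' (show 1 ≤ m by omega)
      simpa using pPoly_eval_one k
    · obtain ⟨k, rfl⟩ := Nat.exists_eq_add_of_le' (show 4 ≤ m by omega)
      simpa using pPoly_eval_aY k
  · interval_cases j
    · simp [pPoly_zero_eval]
    · simpa using pPoly_three_eval_aY

theorem exists_tk_eq {k : ℕ} (hk : 2 ≤ k) :
    ∃ i j, j < 2 ∧ 2 * i + 3 * j = k ∧ tk k = aX ^ i * aY ^ j := by
  rcases Nat.even_or_odd k with h | h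
  · refine ⟨k / 2, 0, by omega, ?_, by simp [tk, h]⟩
    rw [Nat.even_iff] at h
    omega
  · refine ⟨(k - 3) / 2, 1, by omega, ?_, ?_⟩
    · rw [Nat.odd_iff] at h
      omega
    · simp [tk, Nat.not_even_iff_odd.mpr h, mul_comm]

theorem pPoly_eval_tk {k : ℕ} (hk : 2 ≤ k) :
    (pPoly K k).eval (algebraMap A K (tk k)) = 1 := by
  obtain ⟨i, j, hj, rfl, ht⟩ := exists_tk_eq hk
  rw [ht]
  exact (pPoly_eval_monomial i hj).2

theorem mem_monoSet {k : ℕ} {a : A} :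
    a ∈ monoSet k ↔ ∃ i j, j < 2 ∧ 2 * i + 3 * j < k ∧ a = aX ^ i * aY ^ j := by
  simp only [monoSet, Finset.mem_image, Finset.mem_filter, Finset.mem_product, Finset.mem_range,
    Prod.exists]
  constructor
  · rintro ⟨i, j, ⟨⟨-, hj⟩, h⟩, rfl⟩
    exact ⟨i, j, hj, h, rfl⟩
  · rintro ⟨i, j, hj, h, rfl⟩
    exact ⟨i, j, ⟨⟨by omega, hj⟩, h⟩, rfl⟩

theorem pPoly_eval_of_mem_Alt {k : ℕ} {a : A} (ha : a ∈ Alt k) :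
    (pPoly K k).eval (algebraMap A K a) = 0 := by
  simp only [Alt, Finset.mem_image, Finset.mem_powerset] at ha
  obtain ⟨s, hs, rfl⟩ := ha
  induction s using Finset.induction_on with
  | empty => simp [pPoly_eval_zero]
  | insert b s hb ih =>
    rw [Finset.insert_subset_iff] at hs
    obtain ⟨i, j, hj, h, rfl⟩ := mem_monoSet.mp hs.1
    rw [Finset.sum_insert hb, map_add, pPoly_eval_add, ih hs.2]
    simpa using (pPoly_eval_monomial (K := K) i hj).1 k h

end Coefficients

theorem monoSet_succ {k : ℕ} (hk : 2 ≤ k) : monoSet (k + 1) = insert (tk k) (monoSet k) := by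
  ext a
  rw [Finset.mem_insert, mem_monoSet, mem_monoSet]
  constructor
  · rintro ⟨i, j, hj, h, rfl⟩
    rcases Nat.lt_succ_iff_lt_or_eq.mp h with h | h
    · exact Or.inr ⟨i, j, hj, h, rfl⟩
    · left
      obtain ⟨i', j', hj', h', ht⟩ := exists_tk_eq hk
      obtain ⟨rfl, rfl⟩ : i = i' ∧ j = j' := by omega
      exact ht.symm
  · rintro (rfl | ⟨i, j, hj, h, rfl⟩)
    · obtain ⟨i, j, hj, h, ht⟩ := exists_tk_eq hk
      exact ⟨i, j, hj, by omega, ht⟩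
    · exact ⟨i, j, hj, by omega, rfl⟩

theorem zero_mem_Alt (k : ℕ) : (0 : A) ∈ Alt k :=
  Finset.mem_image.mpr ⟨∅, by simp, by simp⟩

theorem monoSet_subset_Alt (k : ℕ) : monoSet k ⊆ Alt k := fun a ha =>
  Finset.mem_image.mpr ⟨{a}, by simpa using ha, by simp⟩

theorem add_self_A (a : A) : a + a = 0 := by
  rw [← two_mul, two_eq_zero_A, zero_mul]

theorem Alt_two : Alt 2 = {0, 1} := by
  have h : monoSet 2 = {1} := by
    ext a
    rw [mem_monoSet, Finset.mem_singleton]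
    constructor
    · rintro ⟨i, j, -, h, rfl⟩
      obtain ⟨rfl, rfl⟩ : i = 0 ∧ j = 0 := by omega
      simp
    · rintro rfl
      exact ⟨0, 0, by simp⟩
  ext a
  simp [Alt, h, Finset.subset_singleton_iff, eq_comm]

theorem tk_notMem_Alt (K : Type) [Field K] [Algebra A K] [IsFractionRing A K]
    {k : ℕ} (hk : 2 ≤ k) : tk k ∉ Alt k := fun h =>
  one_ne_zero ((pPoly_eval_tk (K := K) hk).symm.trans (pPoly_eval_of_mem_Alt h))

theorem Alt_succ (K : Type) [Field K] [Algebra A K] [IsFractionRing A K]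
    {k : ℕ} (hk : 2 ≤ k) :
    Alt (k + 1) = Alt k ∪ (Alt k).image (tk k + ·) := by
  have ht : tk k ∉ monoSet k := fun h => tk_notMem_Alt K hk (monoSet_subset_Alt k h)
  rw [Alt, monoSet_succ hk, Finset.powerset_insert, Finset.image_union, Finset.image_image, Alt,
    Finset.image_image]
  congr 1
  refine Finset.image_congr fun s hs => ?_
  have hs' : tk k ∉ s := fun h => ht (Finset.mem_powerset.mp hs h)
  simp [Finset.sum_insert hs']

theorem mem_Alt_succ (K : Type) [Field K] [Algebra A K] [IsFractionRing A K]
    {k : ℕ} (hk : 2 ≤ k) {a : A} :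
    a ∈ Alt (k + 1) ↔ a ∈ Alt k ∨ ∃ b ∈ Alt k, a = tk k + b := by
  simp only [Alt_succ K hk, Finset.mem_union, Finset.mem_image, eq_comm]

theorem add_mem_Alt (K : Type) [Field K] [Algebra A K] [IsFractionRing A K]
    {k : ℕ} (hk : 2 ≤ k) {a b : A} (ha : a ∈ Alt k) (hb : b ∈ Alt k) :
    a + b ∈ Alt k := by
  induction k, hk using Nat.le_induction generalizing a b with
  | base =>
    rw [Alt_two] at *
    simp only [Finset.mem_insert, Finset.mem_singleton] at *
    rcases ha with rfl | rfl <;> rcases hb with rfl | rfl <;> simp [add_self_A]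
  | succ k hk ih =>
    rw [mem_Alt_succ K hk] at *
    rcases ha with ha | ⟨c, hc, rfl⟩ <;> rcases hb with hb | ⟨d, hd, rfl⟩
    · exact Or.inl (ih ha hb)
    · exact Or.inr ⟨a + d, ih ha hd, by ring⟩
    · exact Or.inr ⟨c + b, ih hc hb, by ring⟩
    · refine Or.inl ?_
      rw [show tk k + c + (tk k + d) = tk k + tk k + (c + d) by ring, add_self_A, zero_add]
      exact ih hc hd

theorem card_Alt (K : Type) [Field K] [Algebra A K] [IsFractionRing A K]
    {k : ℕ} (hk : 1 ≤ k) : (Alt (k + 1)).card = 2 ^ k := by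
  induction k, hk using Nat.le_induction with
  | base =>
    have : (1 : A) ≠ 0 := fun h =>
      one_ne_zero (by rw [← map_one (algebraMap A K), h, map_zero] : (1 : K) = 0)
    simp [Alt_two, this.symm]
  | succ k hk ih =>
    have hk' : 2 ≤ k + 1 := by omega
    rw [Alt_succ K hk', Finset.card_union_of_disjoint, Finset.card_image_of_injective _
      (add_right_injective _), ih]
    · ring
    · rw [Finset.disjoint_left]
      rintro a ha hb
      obtain ⟨b, hb', rfl⟩ := Finset.mem_image.mp hb
      have h := add_mem_Alt K hk' ha hb'
      rw [add_assoc, add_self_A, add_zero] at h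
      exact tk_notMem_Alt K hk' h

theorem ePoly_monic (k : ℕ) : (ePoly k).Monic :=
  monic_prod_of_monic _ _ fun a _ => monic_X_add_C a

theorem ePoly_eval_of_mem {k : ℕ} {a : A} (ha : a ∈ Alt k) : (ePoly k).eval a = 0 := by
  rw [ePoly, eval_prod]
  exact Finset.prod_eq_zero ha (by simp [add_self_A])

theorem ePoly_eval_tk_add (K : Type) [Field K] [Algebra A K] [IsFractionRing A K]
    {k : ℕ} (hk : 2 ≤ k) {a : A} (ha : a ∈ Alt k) :
    (ePoly k).eval (tk k + a) = Dk k := by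
  rw [Dk, ePoly, eval_prod, eval_prod]
  have h (b : A) : a + (a + b) = b := by rw [← add_assoc, add_self_A, zero_add]
  refine Finset.prod_nbij' (a + ·) (a + ·) (fun b hb => add_mem_Alt K hk ha hb)
    (fun b hb => add_mem_Alt K hk ha hb) (fun b _ => h b) (fun b _ => h b) fun b _ => ?_
  simp [add_assoc]

theorem natDegree_ePoly_map (K : Type) [Field K] [Algebra A K] [IsFractionRing A K]
    {k : ℕ} (hk : 1 ≤ k) :
    ((ePoly (k + 1)).map (algebraMap A K)).natDegree = 2 ^ k := by
  rw [ePoly, Polynomial.map_prod, natDegree_prod_of_monic]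
  · simp [card_Alt K hk]
  · intro a _
    simpa using monic_X_add_C (algebraMap A K a)

/-- For `k ≥ 2`, in `K[w]`:
`D_k·p_k(w) = a_k·D_k·e_k(w)² + (1 + a_k·D_k²)·e_k(w)`
(equivalently, with `d_k = 1/a_k`: `p_k = e_k²/d_k + C·e_k` where
`C = 1/D_k + D_k/d_k`). -/
theorem stmt15 [IsFractionRing A K] (k : ℕ) (hk : 2 ≤ k) :
    C (algebraMap A K (Dk k)) * pPoly K k =
      C (aSeq K k * algebraMap A K (Dk k)) * ((ePoly k).map (algebraMap A K)) ^ 2 +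
        C (1 + aSeq K k * (algebraMap A K (Dk k)) ^ 2) *
          (ePoly k).map (algebraMap A K) := by
  have : CharP K 2 := charP_two
  have h2 := CharTwo.two_eq_zero (R := K)
  set e := (ePoly k).map (algebraMap A K) with he
  set D := algebraMap A K (Dk k) with hD
  have hmonic : (e ^ 2).Monic := ((ePoly_monic k).map _).pow 2
  have hdeg : e.natDegree = 2 ^ (k - 1) := by
    have h := natDegree_ePoly_map K (show 1 ≤ k - 1 by omega)
    rwa [Nat.sub_add_cancel (by omega)] at h
  have hdeg2 : (e ^ 2).natDegree = 2 ^ k := by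
    rw [((ePoly_monic k).map _).natDegree_pow, hdeg, ← pow_succ', Nat.sub_add_cancel (by omega)]
  have hsq : X ^ 2 ^ k - e ^ 2 ∈ degreeLT K (2 ^ k) := by
    have h : (X ^ 2 ^ k : K[X]).degree = (e ^ 2).degree := by
      rw [degree_X_pow, degree_eq_natDegree hmonic.ne_zero, hdeg2]
    rw [mem_degreeLT]
    exact (degree_sub_lt_left h (pow_ne_zero _ X_ne_zero) (by
      rw [hmonic.leadingCoeff, (monic_X_pow _).leadingCoeff])).trans_eq (degree_X_pow _)
  have hlin : e ∈ degreeLT K (2 ^ k) := by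
    rw [mem_degreeLT, degree_eq_natDegree ((ePoly_monic k).map _).ne_zero, hdeg]
    exact_mod_cast Nat.pow_lt_pow_right one_lt_two (by omega : k - 1 < k)
  rw [← sub_eq_zero]
  refine eq_zero_of_degree_lt_of_eval_finset_eq_zero ((Alt (k + 1)).image (algebraMap A K)) ?_ ?_
  · rw [Finset.card_image_of_injective _ (IsFractionRing.injective A K),
      card_Alt K (by omega : 1 ≤ k), ← mem_degreeLT]
    have h := sub_mem (add_mem (Submodule.smul_mem _ D (pPoly_sub_mem_degreeLT k))
      (Submodule.smul_mem _ (aSeq K k * D) hsq))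
      (Submodule.smul_mem _ (1 + aSeq K k * D ^ 2) hlin)
    convert h using 1
    simp only [smul_eq_C_mul, C_mul]
    ring
  · intro z hz
    obtain ⟨a, ha, rfl⟩ := Finset.mem_image.mp hz
    simp only [eval_sub, eval_add, eval_mul, eval_C, eval_pow, he, eval_map_apply]
    rcases (mem_Alt_succ K hk).mp ha with ha | ⟨b, hb, rfl⟩
    · simp [pPoly_eval_of_mem_Alt ha, ePoly_eval_of_mem ha]
    · rw [ePoly_eval_tk_add K hk hb, map_add, pPoly_eval_add, pPoly_eval_tk hk,
        pPoly_eval_of_mem_Alt hb, ← hD]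
      linear_combination -(aSeq K k * D ^ 3) * h2
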